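/- Let σ > 0 and let μ be the Gaussian law N(m, σ²) on ℝ. For every R ≥ 0, the distortion-rate function D(R) of the memoryless source with marginal μ, defined as the infimum of all D ≥ 0 such that the pair (R, D) is achievable, equals σ² · 2^(−2R). (Theorem 1 of the paper, distortion-rate form, for a Gaussian memoryless scalar source.) -/

import Mathlib

open MeasureTheory ProbabilityTheory

/-- Expected per-symbol squared-error distortion of a blocklength-`n` code `(f, g)`
with `M` codewords on a source with i.i.d. components of law `μ`. -/
noncomputable def expectedDistortion (n M : ℕ) (μ : Measure ℝ)
    (f : (Fin n → ℝ) → Fin M) (g : Fin M → (Fin n → ℝ)) : ℝ :=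
  ∫ x, (1 / (n : ℝ)) * ∑ i, (x i - g (f x) i) ^ 2 ∂(Measure.pi fun _ : Fin n => μ)

/-- A pair `(R, D)` is achievable for the memoryless source with marginal `μ` if for
every `ε > 0` there are a blocklength `n ≥ 1` and a code with at most `2 ^ (n (R + ε))`
codewords whose expected per-symbol distortion is at most `D + ε`. -/
def IsAchievable (μ : Measure ℝ) (R D : ℝ) : Prop :=
  ∀ ε > (0 : ℝ), ∃ (n M : ℕ) (f : (Fin n → ℝ) → Fin M) (g : Fin M → (Fin n → ℝ)),
    1 ≤ n ∧ Measurable f ∧ (M : ℝ) ≤ 2 ^ ((n : ℝ) * (R + ε)) ∧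
    expectedDistortion n M μ f g ≤ D + ε

lemma gdr_one_dim (m a v D : ℝ) (hv : 0 < v) (hD : 0 < D) :
    ∫ x, Real.exp (-(x - a) ^ 2 / (2 * D) + (x - m) ^ 2 / (2 * v)) ∂(gaussianReal m v.toNNReal)
      = √(D / v) := by
  have hv' : v.toNNReal ≠ 0 := by simpa using hv
  rw [integral_gaussianReal_eq_integral_smul hv']
  have h1 : ∀ x, gaussianPDFReal m v.toNNReal x •
      Real.exp (-(x - a) ^ 2 / (2 * D) + (x - m) ^ 2 / (2 * v))
      = (√(2 * Real.pi * v))⁻¹ * Real.exp (-(1 / (2 * D)) * (x - a) ^ 2) := by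
    intro x
    rw [gaussianPDFReal, smul_eq_mul, mul_assoc, ← Real.exp_add, Real.coe_toNNReal _ hv.le]
    congr 2
    ring
  simp_rw [h1]
  rw [integral_const_mul, integral_sub_right_eq_self (fun x => Real.exp (-(1 / (2 * D)) * x ^ 2)) a,
    integral_gaussian, ← Real.sqrt_inv, ← Real.sqrt_mul (by positivity)]
  congr 1
  have := Real.pi_pos
  field_simp

lemma gdr_sq_integrable (m : ℝ) (v : NNReal) (c : ℝ) :
    Integrable (fun x => (x - c) ^ 2) (gaussianReal m v) := by
  have h : MemLp (fun x : ℝ => x - c) 2 (gaussianReal m v) :=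
    (memLp_id_gaussianReal' 2 (by simp)).sub (memLp_const c)
  exact h.integrable_sq

lemma gdr_var (m v : ℝ) (hv : 0 < v) :
    ∫ x, (x - m) ^ 2 ∂(gaussianReal m v.toNNReal) = v := by
  have h := variance_fun_id_gaussianReal (μ := m) (v := v.toNNReal)
  rw [variance_eq_integral (by fun_prop)] at h
  simpa [integral_id_gaussianReal, hv.le] using h

lemma gdr_dist_integrable (n M : ℕ) (μ : Measure ℝ) [IsProbabilityMeasure μ]
    (hμ : ∀ c, Integrable (fun x => (x - c) ^ 2) μ)
    (f : (Fin n → ℝ) → Fin M) (hf : Measurable f) (g : Fin M → (Fin n → ℝ)) (i : Fin n) :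
    Integrable (fun x => (x i - g (f x) i) ^ 2) (Measure.pi fun _ : Fin n => μ) := by
  have hm : Measurable (fun x => g (f x) i) :=
    (measurable_of_finite (fun j => g j i)).comp hf
  refine Integrable.mono' (g := fun x => ∑ j, (x i - g j i) ^ 2) ?_ ?_ ?_
  · refine integrable_finsetSum _ fun j _ => ?_
    exact integrable_comp_eval (μ := fun _ : Fin n => μ) (i := i) (hμ (g j i))
  · exact (((measurable_pi_apply i).sub hm).pow_const 2).aestronglyMeasurable
  · refine Filter.Eventually.of_forall fun x => ?_
    rw [Real.norm_of_nonneg (sq_nonneg _)]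
    exact Finset.single_le_sum (f := fun j => (x i - g j i) ^ 2)
      (fun j _ => sq_nonneg _) (Finset.mem_univ (f x))

lemma gdr_converse (m v D : ℝ) (hv : 0 < v) (hD : 0 < D) (n M : ℕ) (hn : 1 ≤ n)
    (f : (Fin n → ℝ) → Fin M) (hf : Measurable f) (g : Fin M → (Fin n → ℝ))
    (hM : (M : ℝ) * √(D / v) ^ n ≤ 1) :
    D ≤ expectedDistortion n M (gaussianReal m v.toNNReal) f g := by
  set μ := gaussianReal m v.toNNReal with hμ
  set P := Measure.pi fun _ : Fin n => μ with hP
  have hsq : ∀ c, Integrable (fun x => (x - c) ^ 2) μ := gdr_sq_integrable m _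
  have hd := gdr_dist_integrable n M μ hsq f hf g
  have hm : ∀ i, Integrable (fun x : Fin n → ℝ => (x i - m) ^ 2) P := fun i =>
    integrable_comp_eval (μ := fun _ : Fin n => μ) (i := i) (hsq m)
  let h : Fin M → (Fin n → ℝ) → ℝ := fun j x =>
    ∏ i, Real.exp (-(x i - g j i) ^ 2 / (2 * D) + (x i - m) ^ 2 / (2 * v))
  have hpos : 0 < √(D / v) := Real.sqrt_pos.mpr (by positivity)
  have hint : ∀ j, Integrable (h j) P := by
    intro j
    refine Integrable.fintype_prod_dep (μ := fun _ : Fin n => μ)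
      (f := fun i x => Real.exp (-(x - g j i) ^ 2 / (2 * D) + (x - m) ^ 2 / (2 * v))) ?_
    intro i
    refine Integrable.of_integral_ne_zero ?_
    rw [hμ, gdr_one_dim m _ v D hv hD]
    exact hpos.ne'
  have hval : ∀ j, ∫ x, h j x ∂P = √(D / v) ^ n := by
    intro j
    rw [integral_fintype_prod_eq_prod (μ := fun _ : Fin n => μ)
      (f := fun i x => Real.exp (-(x - g j i) ^ 2 / (2 * D) + (x - m) ^ 2 / (2 * v)))]
    rw [hμ]
    simp [gdr_one_dim m _ v D hv hD]
  have hpt : ∀ x, 1 + ((-1 / (2 * D)) * (∑ i, (x i - g (f x) i) ^ 2)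
      + (1 / (2 * v)) * ∑ i, (x i - m) ^ 2) ≤ ∑ j, h j x := by
    intro x
    have h1 : h (f x) x ≤ ∑ j, h j x :=
      Finset.single_le_sum (f := fun j => h j x)
        (fun j _ => Finset.prod_nonneg fun i _ => (Real.exp_pos _).le) (Finset.mem_univ (f x))
    refine le_trans ?_ h1
    simp only [h]
    rw [← Real.exp_sum, add_comm]
    refine le_trans (Real.add_one_le_exp _) (le_of_eq ?_)
    congr 1
    rw [Finset.mul_sum, Finset.mul_sum, ← Finset.sum_add_distrib]
    refine Finset.sum_congr rfl fun i _ => ?_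
    ring
  have hi1 : Integrable (fun x => (-1 / (2 * D)) * (∑ i, (x i - g (f x) i) ^ 2)) P :=
    (integrable_finsetSum _ fun i _ => hd i).const_mul _
  have hi2 : Integrable (fun x : Fin n → ℝ => (1 / (2 * v)) * (∑ i, (x i - m) ^ 2)) P :=
    (integrable_finsetSum _ fun i _ => hm i).const_mul _
  have hi12 : Integrable (fun x : Fin n → ℝ => (-1 / (2 * D)) * (∑ i, (x i - g (f x) i) ^ 2)
      + (1 / (2 * v)) * (∑ i, (x i - m) ^ 2)) P := hi1.add hi2
  have key := integral_mono ((integrable_const 1).add hi12)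
    (integrable_finsetSum _ fun j _ => hint j) hpt
  simp only [Pi.add_apply] at key
  rw [integral_add (integrable_const 1) hi12, integral_add hi1 hi2,
    integral_finsetSum _ (fun j _ => hint j)] at key
  simp only [hval, integral_const_mul] at key
  rw [integral_finsetSum _ (fun i _ => hm i)] at key
  have hmi : ∀ i : Fin n, ∫ x : Fin n → ℝ, (x i - m) ^ 2 ∂P = v := by
    intro i
    rw [hP, integral_comp_eval (μ := fun _ : Fin n => μ) (i := i) (f := fun y => (y - m) ^ 2)
      (hsq m).aestronglyMeasurable]
    exact gdr_var m v hv
  simp only [hmi] at key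
  simp at key
  unfold expectedDistortion
  rw [integral_const_mul, ← hP]
  set E := ∫ x, ∑ i, (x i - g (f x) i) ^ 2 ∂P
  have hn' : (0 : ℝ) < n := by exact_mod_cast hn
  have k2 : -1 / (2 * D) * E + n / 2 ≤ 0 := by
    have : v⁻¹ * 2⁻¹ * (n * v) = n / 2 := by field_simp
    linarith
  have k3 : n * D ≤ E := by
    have : -1 / (2 * D) * E + n / 2 = (n * D - E) / (2 * D) := by field_simp; ring
    rw [this] at k2
    by_contra hc
    push Not at hc
    have : 0 < (n * D - E) / (2 * D) := by apply div_pos <;> linarith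
    linarith
  rw [one_div, ← div_eq_inv_mul, le_div_iff₀ hn']
  linarith

lemma gdr_cover {X Y : Type*} [MeasurableSpace X] [MeasurableSpace Y]
    (P : Measure X) [IsProbabilityMeasure P] (Q : Measure Y) [IsProbabilityMeasure Q]
    (G : Set (X × Y)) (hG : MeasurableSet G) (T : Set X) (hT : MeasurableSet T)
    (q : ℝ) (hq0 : 0 ≤ q) (hq1 : q ≤ 1)
    (hq : ∀ x ∈ T, ENNReal.ofReal q ≤ Q (Prod.mk x ⁻¹' G)) (y0 : Y) (M : ℕ) :
    ∃ (f : X → Fin (M + 1)) (g : Fin (M + 1) → Y) (U : Set X), Measurable f ∧ MeasurableSet U ∧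
      U ⊆ T ∧
      g 0 = y0 ∧ P U ≤ ENNReal.ofReal ((1 - q) ^ M) ∧ (∀ x ∈ T, x ∉ U → (x, g (f x)) ∈ G) ∧
      (∀ x, (x, g (f x)) ∈ G ∨ f x = 0) := by
  induction M with
  | zero =>
    refine ⟨fun _ => 0, fun _ => y0, T, measurable_const, hT, subset_rfl, rfl, ?_, ?_, ?_⟩
    · simpa using prob_le_one
    · intro x hx hx'; exact absurd hx hx'
    · intro x; exact Or.inr rfl
  | succ M ih =>
    obtain ⟨f, g, U, hf, hU, hUT, hg0, hPU, h1, h2⟩ := ih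
    -- choose `y`
    have hex : ∃ y, ENNReal.ofReal q * P U ≤ P (U ∩ (fun x => (x, y)) ⁻¹' G) := by
      by_contra hc
      push Not at hc
      have hGU : MeasurableSet ((U ×ˢ Set.univ) ∩ G) := (hU.prod MeasurableSet.univ).inter hG
      have e1 : (P.prod Q) ((U ×ˢ Set.univ) ∩ G)
          = ∫⁻ y, P (U ∩ (fun x => (x, y)) ⁻¹' G) ∂Q := by
        rw [Measure.prod_apply_symm hGU]
        refine lintegral_congr fun y => ?_
        congr 1
        ext x; simp
      have e2 : ENNReal.ofReal q * P U ≤ (P.prod Q) ((U ×ˢ Set.univ) ∩ G) := by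
        rw [Measure.prod_apply hGU]
        calc ENNReal.ofReal q * P U = ∫⁻ x in U, ENNReal.ofReal q ∂P := by simp
          _ ≤ ∫⁻ x in U, Q (Prod.mk x ⁻¹' ((U ×ˢ Set.univ) ∩ G)) ∂P := by
              refine setLIntegral_mono' hU fun x hx => ?_
              refine (hq x (hUT hx)).trans (measure_mono ?_)
              intro y hy
              exact ⟨⟨hx, trivial⟩, hy⟩
          _ ≤ _ := setLIntegral_le_lintegral _ _
      rw [e1] at e2
      have e3 : ∫⁻ y, P (U ∩ (fun x => (x, y)) ⁻¹' G) ∂Q < ∫⁻ y, ENNReal.ofReal q * P U ∂Q := by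
        refine lintegral_strict_mono (NeZero.ne Q) measurable_const.aemeasurable ?_
          (Filter.Eventually.of_forall hc)
        refine ne_top_of_le_ne_top (b := 1) (by simp) ?_
        calc _ ≤ ∫⁻ y, 1 ∂Q := lintegral_mono fun y => prob_le_one
          _ = 1 := by simp
      simp only [lintegral_const, measure_univ, mul_one] at e3
      exact absurd e2 (not_le.mpr e3)
    obtain ⟨y, hy⟩ := hex
    have hS : MeasurableSet (U ∩ (fun x => (x, y)) ⁻¹' G) :=
      hU.inter (measurable_prodMk_right hG)
    classical
    refine ⟨fun x => if x ∈ U ∩ (fun x => (x, y)) ⁻¹' G then Fin.last (M + 1) else (f x).castSucc,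
      Fin.snoc (α := fun _ => Y) g y, U \ (U ∩ (fun x => (x, y)) ⁻¹' G), ?_, hU.diff hS,
      Set.sdiff_subset.trans hUT, ?_, ?_, ?_, ?_⟩
    · exact Measurable.ite hS measurable_const ((measurable_of_finite _).comp hf)
    · rw [← hg0]
      exact Fin.snoc_castSucc (α := fun _ => Y) y g 0
    · rw [measure_sdiff Set.inter_subset_left hS.nullMeasurableSet (measure_ne_top _ _)]
      have hfin : P U ≠ ⊤ := measure_ne_top _ _
      calc P U - P (U ∩ (fun x => (x, y)) ⁻¹' G) ≤ P U - ENNReal.ofReal q * P U :=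
            tsub_le_tsub_left hy _
        _ = ENNReal.ofReal (1 - q) * P U := by
            rw [ENNReal.ofReal_sub _ hq0, ENNReal.sub_mul (fun _ _ => hfin)]
            simp
        _ ≤ ENNReal.ofReal (1 - q) * ENNReal.ofReal ((1 - q) ^ M) := by gcongr
        _ = _ := by rw [← ENNReal.ofReal_mul (by linarith), pow_succ']
    · intro x hx hx'
      by_cases hxx : x ∈ U ∩ (fun x => (x, y)) ⁻¹' G
      · simp only [hxx, if_true, Fin.snoc_last]
        exact hxx.2
      · simp only [hxx, if_false, Fin.snoc_castSucc]
        exact h1 x hx fun hxU => hx' ⟨hxU, hxx⟩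
    · intro x
      by_cases hxx : x ∈ U ∩ (fun x => (x, y)) ⁻¹' G
      · left
        simp only [hxx, if_true, Fin.snoc_last]
        exact hxx.2
      · simp only [hxx, if_false, Fin.snoc_castSucc]
        rcases h2 x with h | h
        · exact Or.inl h
        · right; rw [h]; rfl

lemma gdr_pi_withDensity {n : ℕ} (f : Fin n → ℝ → ℝ) (h0 : ∀ i x, 0 ≤ f i x)
    (hi : ∀ i, Integrable (f i) volume) :
    Measure.pi (fun i => (volume : Measure ℝ).withDensity (fun x => ENNReal.ofReal (f i x)))
      = (volume : Measure (Fin n → ℝ)).withDensity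
          (fun x => ENNReal.ofReal (∏ i, f i (x i))) := by
  have : ∀ i, IsFiniteMeasure
      ((volume : Measure ℝ).withDensity (fun x => ENNReal.ofReal (f i x))) := fun i =>
    isFiniteMeasure_withDensity_ofReal (hi i).2
  refine Measure.pi_eq fun s hs => ?_
  rw [withDensity_apply _ (MeasurableSet.univ_pi hs), volume_pi, Measure.restrict_pi_pi]
  rw [← ofReal_integral_eq_lintegral_ofReal
      (Integrable.fintype_prod_dep (μ := fun i => (volume : Measure ℝ).restrict (s i))
        (f := f) fun i => (hi i).restrict)
      (Filter.Eventually.of_forall fun x => Finset.prod_nonneg fun i _ => h0 _ _),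
    integral_fintype_prod_eq_prod (μ := fun i => (volume : Measure ℝ).restrict (s i)) (f := f),
    ENNReal.ofReal_prod_of_nonneg (fun i _ => integral_nonneg (h0 i))]
  refine Finset.prod_congr rfl fun i _ => ?_
  rw [withDensity_apply _ (hs i), ofReal_integral_eq_lintegral_ofReal (hi i).restrict
    (Filter.Eventually.of_forall (h0 i))]

lemma gdr_pi_gaussian {n : ℕ} (c : Fin n → ℝ) (v : NNReal) (hv : v ≠ 0) :
    Measure.pi (fun i => gaussianReal (c i) v)
      = (volume : Measure (Fin n → ℝ)).withDensity
          (fun x => ENNReal.ofReal (∏ i, gaussianPDFReal (c i) v (x i))) := by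
  rw [← gdr_pi_withDensity (fun i => gaussianPDFReal (c i) v)
    (fun i x => gaussianPDFReal_nonneg _ _ _)
    (fun i => integrable_gaussianPDFReal _ _)]
  congr 1
  funext i
  rw [gaussianReal_of_var_ne_zero _ hv]
  rfl

lemma gdr_pdf (m v D : ℝ) (hD : 0 < D) (hDv : D < v) (x y : ℝ) :
    gaussianPDFReal (m + (1 - D / v) * (x - m)) ((1 - D / v) * D).toNNReal y
      = gaussianPDFReal m (v - D).toNNReal y *
        (√(v / D) * Real.exp ((x - m) ^ 2 / (2 * v) - (x - y) ^ 2 / (2 * D))) := by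
  have hv : 0 < v := hD.trans hDv
  have ha : 0 < 1 - D / v := by rw [sub_pos, div_lt_one hv]; exact hDv
  have hvD : 0 < v - D := sub_pos.mpr hDv
  have haD : 1 - D / v = (v - D) / v := by field_simp
  rw [gaussianPDFReal, gaussianPDFReal, Real.coe_toNNReal _ (by positivity),
    Real.coe_toNNReal _ hvD.le]
  have e1 : (√(2 * Real.pi * ((1 - D / v) * D)))⁻¹ = (√(2 * Real.pi * (v - D)))⁻¹ * √(v / D) := by
    rw [← Real.sqrt_inv, ← Real.sqrt_inv, ← Real.sqrt_mul (by positivity)]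
    congr 1
    have := Real.pi_pos
    rw [haD]
    field_simp
  have e2 : Real.exp (-(y - (m + (1 - D / v) * (x - m))) ^ 2 / (2 * ((1 - D / v) * D)))
      = Real.exp (-(y - m) ^ 2 / (2 * (v - D))) *
        Real.exp ((x - m) ^ 2 / (2 * v) - (x - y) ^ 2 / (2 * D)) := by
    rw [← Real.exp_add]
    congr 1
    rw [haD]
    have := hvD.ne'
    field_simp
    ring
  rw [e1, e2]
  ring

lemma gdr_fourth (c : ℝ) (w : NNReal) :
    ∫ y, (y - c) ^ 4 ∂(gaussianReal c w) = ∫ y, y ^ 4 ∂(gaussianReal 0 w) := by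
  have h := gaussianReal_map_sub_const (μ := c) (v := w) c
  rw [sub_self] at h
  rw [← h, integral_map (by fun_prop) (by fun_prop)]

lemma gdr_sq_memLp (c : ℝ) (w : NNReal) (x : ℝ) :
    MemLp (fun y => (x - y) ^ 2) 2 (gaussianReal c w) := by
  have h : MemLp (fun y : ℝ => x - y) 4 (gaussianReal c w) :=
    (memLp_const x).sub (memLp_id_gaussianReal' 4 (by simp))
  have h2 := h.norm_rpow_div 2
  have e : (4 : ENNReal) / 2 = 2 := by
    rw [show (4 : ENNReal) = 2 * 2 by norm_num]
    exact ENNReal.mul_div_cancel_right (by simp) (by simp)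
  rw [e] at h2
  simpa using h2

lemma gdr_mean (c w : ℝ) (hw : 0 < w) (x : ℝ) :
    ∫ y, (x - y) ^ 2 ∂(gaussianReal c w.toNNReal) = (x - c) ^ 2 + w := by
  have h1 : MemLp (fun y : ℝ => y) 2 (gaussianReal c w.toNNReal) :=
    memLp_id_gaussianReal' 2 (by simp)
  have h2 : Integrable (fun y : ℝ => y) (gaussianReal c w.toNNReal) := h1.integrable (by simp)
  have e : ∀ y : ℝ, (x - y) ^ 2 = ((x - c) ^ 2 + (-(2 * (x - c))) * (y - c)) + (y - c) ^ 2 := by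
    intro y; ring
  rw [integral_congr_ae (Filter.Eventually.of_forall e)]
  have i3 : Integrable (fun y : ℝ => (-(2 * (x - c))) * (y - c)) (gaussianReal c w.toNNReal) :=
    (h2.sub (integrable_const c)).const_mul _
  have i4 : Integrable (fun y : ℝ => (x - c) ^ 2 + (-(2 * (x - c))) * (y - c))
      (gaussianReal c w.toNNReal) := (integrable_const _).add i3
  rw [integral_add i4 (gdr_sq_integrable _ _ _), integral_add (integrable_const _) i3,
    gdr_var c w hw, integral_const_mul, integral_sub h2 (integrable_const _),
    integral_id_gaussianReal]
  simp

lemma gdr_variance (c w : ℝ) (hw : 0 < w) (x : ℝ) :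
    Var[fun y => (x - y) ^ 2; gaussianReal c w.toNNReal]
      ≤ 2 * (∫ y, y ^ 4 ∂(gaussianReal 0 w.toNNReal)) + 8 * (x - c) ^ 2 * w := by
  have hmem := gdr_sq_memLp c w.toNNReal x
  rw [← variance_sub_const hmem.aestronglyMeasurable ((x - c) ^ 2)]
  refine (variance_le_expectation_sq (by fun_prop)).trans ?_
  have i4 : Integrable (fun y => (y - c) ^ 4) (gaussianReal c w.toNNReal) := by
    have := (gdr_sq_memLp c w.toNNReal c).integrable_sq
    refine this.congr (Filter.Eventually.of_forall fun y => ?_)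
    simp only; ring
  have i2 := gdr_sq_integrable c w.toNNReal c
  have e : 2 * (∫ y, y ^ 4 ∂(gaussianReal 0 w.toNNReal)) + 8 * (x - c) ^ 2 * w
      = ∫ y, (2 * (y - c) ^ 4 + 8 * (x - c) ^ 2 * (y - c) ^ 2) ∂(gaussianReal c w.toNNReal) := by
    rw [integral_add (i4.const_mul _) (i2.const_mul _), integral_const_mul, integral_const_mul,
      gdr_var c w hw, gdr_fourth]
  rw [e]
  refine integral_mono ?_ ((i4.const_mul _).add (i2.const_mul _)) ?_
  · exact (hmem.sub (memLp_const ((x - c) ^ 2))).integrable_sq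
  · intro y
    simp only [Pi.pow_apply]
    nlinarith [sq_nonneg ((y - c) ^ 2 + 2 * (x - c) * (y - c))]

lemma gdr_sum_memLp {n : ℕ} (c : Fin n → ℝ) (w : NNReal) (x : Fin n → ℝ) :
    MemLp (fun y : Fin n → ℝ => ∑ i, (x i - y i) ^ 2) 2
      (Measure.pi fun i => gaussianReal (c i) w) := by
  refine memLp_finsetSum _ fun i _ => ?_
  exact (gdr_sq_memLp (c i) w (x i)).comp_measurePreserving
    (measurePreserving_eval (fun i => gaussianReal (c i) w) i)

lemma gdr_sum_mean {n : ℕ} (c : Fin n → ℝ) (w : ℝ) (hw : 0 < w) (x : Fin n → ℝ) :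
    ∫ y, ∑ i, (x i - y i) ^ 2 ∂(Measure.pi fun i => gaussianReal (c i) w.toNNReal)
      = ∑ i, (x i - c i) ^ 2 + n * w := by
  have hi : ∀ i, Integrable (fun y => (x i - y) ^ 2) (gaussianReal (c i) w.toNNReal) := fun i =>
    (gdr_sq_memLp (c i) w.toNNReal (x i)).integrable (by simp)
  rw [integral_finsetSum _ fun i _ => integrable_comp_eval
    (μ := fun i => gaussianReal (c i) w.toNNReal) (i := i) (f := fun y => (x i - y) ^ 2) (hi i)]
  have : ∀ i, ∫ y : Fin n → ℝ, (x i - y i) ^ 2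
      ∂(Measure.pi fun i => gaussianReal (c i) w.toNNReal) = (x i - c i) ^ 2 + w := by
    intro i
    rw [integral_comp_eval (μ := fun i => gaussianReal (c i) w.toNNReal) (i := i)
      (f := fun y => (x i - y) ^ 2) (hi i).aestronglyMeasurable, gdr_mean _ _ hw]
  simp [this, Finset.sum_add_distrib]

lemma gdr_sum_variance {n : ℕ} (c : Fin n → ℝ) (w : ℝ) (hw : 0 < w) (x : Fin n → ℝ) :
    Var[fun y : Fin n → ℝ => ∑ i, (x i - y i) ^ 2;
        Measure.pi fun i => gaussianReal (c i) w.toNNReal]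
      ≤ n * (2 * (∫ y, y ^ 4 ∂(gaussianReal 0 w.toNNReal))) + 8 * w * ∑ i, (x i - c i) ^ 2 := by
  have h := variance_sum_pi (μ := fun i => gaussianReal (c i) w.toNNReal)
    (X := fun i y => (x i - y) ^ 2) (fun i => gdr_sq_memLp (c i) w.toNNReal (x i))
  have e : (∑ i, fun y : Fin n → ℝ => (x i - y i) ^ 2) = fun y => ∑ i, (x i - y i) ^ 2 := by
    funext y; simp
  rw [e] at h
  rw [h]
  refine (Finset.sum_le_sum fun i _ => gdr_variance (c i) w hw (x i)).trans (le_of_eq ?_)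
  rw [Finset.sum_add_distrib, Finset.mul_sum]
  simp only [Finset.sum_const, Finset.card_univ, Fintype.card_fin, nsmul_eq_mul]
  congr 1
  exact Finset.sum_congr rfl fun i _ => by ring

lemma gdr_qbound (m v D : ℝ) (hD : 0 < D) (hDv : D < v) (δ : ℝ) (hδ : 0 < δ) :
    ∃ N : ℕ, ∀ n : ℕ, N ≤ n → ∀ x : Fin n → ℝ,
      |∑ i, (x i - m) ^ 2 - n * v| ≤ n * (δ / 2) →
      ENNReal.ofReal ((1 / 2) * (√(v / D) ^ n * Real.exp (n * (δ / (4 * v) + δ / (2 * D))))⁻¹) ≤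
        (Measure.pi fun _ : Fin n => gaussianReal m (v - D).toNNReal)
          {y | ∑ i, (x i - y i) ^ 2 ≤ n * (D + δ)} := by
  have hv : 0 < v := hD.trans hDv
  have ha : 0 < 1 - D / v := by rw [sub_pos, div_lt_one hv]; exact hDv
  have hvD : 0 < v - D := sub_pos.mpr hDv
  have hr : D / v ≤ 1 := by linarith
  have hr0 : 0 < D / v := by positivity
  set w := (1 - D / v) * D with hw
  have hw0 : 0 < w := by positivity
  set K := ∫ y, y ^ 4 ∂(gaussianReal 0 w.toNNReal) with hK
  set C := 2 * K + 8 * w * (v + δ / 2) with hC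
  obtain ⟨N, hN⟩ := exists_nat_gt (8 * C / δ ^ 2)
  refine ⟨N + 1, fun n hn x hx => ?_⟩
  have hn0 : (0 : ℝ) < n := by exact_mod_cast (by omega : 0 < n)
  have hnC : 8 * C ≤ n * δ ^ 2 := by
    rw [div_lt_iff₀ (by positivity)] at hN
    have : (N : ℝ) ≤ n := by exact_mod_cast (by omega : N ≤ n)
    nlinarith [sq_nonneg δ]
  set S := ∑ i, (x i - m) ^ 2 with hS
  set c : Fin n → ℝ := fun i => m + (1 - D / v) * (x i - m) with hc
  set W := Measure.pi fun i => gaussianReal (c i) w.toNNReal with hWdef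
  set Q := Measure.pi fun _ : Fin n => gaussianReal m (v - D).toNNReal with hQdef
  have hxc : ∑ i, (x i - c i) ^ 2 = (D / v) ^ 2 * S := by
    rw [hS, Finset.mul_sum]
    refine Finset.sum_congr rfl fun i _ => ?_
    simp only [hc]; ring
  have hmean := gdr_sum_mean c w hw0 x
  have hvar := gdr_sum_variance c w hw0 x
  rw [← hWdef, hxc] at hmean hvar
  rw [abs_le] at hx
  have hS0 : 0 ≤ S := Finset.sum_nonneg fun i _ => sq_nonneg _
  have hr2 : (D / v) ^ 2 ≤ 1 := by nlinarith
  have hvar' : Var[fun y : Fin n → ℝ => ∑ i, (x i - y i) ^ 2; W] ≤ n * C := by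
    refine hvar.trans ?_
    have h1 : (D / v) ^ 2 * S ≤ n * (v + δ / 2) := by nlinarith
    have h2 := mul_le_mul_of_nonneg_left h1 (by positivity : 0 ≤ 8 * w)
    rw [hC]; linarith
  have hdev : |((D / v) ^ 2 * S + n * w) - n * D| ≤ n * (δ / 2) := by
    have : ((D / v) ^ 2 * S + n * w) - n * D = (D / v) ^ 2 * (S - n * v) := by
      rw [hw]; field_simp; ring
    rw [this, abs_mul, abs_of_nonneg (sq_nonneg _)]
    have h3 : |S - n * v| ≤ n * (δ / 2) := abs_le.mpr hx
    have := mul_le_mul hr2 h3 (abs_nonneg _) zero_le_one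
    linarith
  set G : Set (Fin n → ℝ) := {y | n * (D - δ) ≤ ∑ i, (x i - y i) ^ 2 ∧
    ∑ i, (x i - y i) ^ 2 ≤ n * (D + δ)} with hG
  have hmeasG : MeasurableSet G := by
    have m1 : MeasurableSet {y : Fin n → ℝ | n * (D - δ) ≤ ∑ i, (x i - y i) ^ 2} :=
      measurableSet_le (by fun_prop) (by fun_prop)
    have m2 : MeasurableSet {y : Fin n → ℝ | ∑ i, (x i - y i) ^ 2 ≤ n * (D + δ)} :=
      measurableSet_le (by fun_prop) (by fun_prop)
    exact m1.inter m2
  have hcheb := meas_ge_le_variance_div_sq (gdr_sum_memLp c w.toNNReal x)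
    (c := n * (δ / 2)) (by positivity)
  rw [← hWdef, hmean] at hcheb
  have hWGc : W Gᶜ ≤ ENNReal.ofReal (1 / 2) := by
    refine (measure_mono ?_).trans (hcheb.trans (ENNReal.ofReal_le_ofReal ?_))
    · intro y hy
      simp only [hG, Set.mem_compl_iff, Set.mem_ofPred_eq, not_and_or, not_le] at hy ⊢
      rw [abs_le] at hdev
      rw [le_abs]
      rcases hy with hy | hy
      · right; linarith [hdev.1]
      · left; linarith [hdev.2]
    · rw [div_le_iff₀ (by positivity)]
      refine hvar'.trans ?_
      nlinarith
  have hWG : ENNReal.ofReal (1 / 2) ≤ W G := by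
    have h1 := prob_compl_eq_one_sub (μ := W) hmeasG
    have h2 : 1 - W G ≤ ENNReal.ofReal (1 / 2) := h1 ▸ hWGc
    rw [tsub_le_iff_right] at h2
    have h3 : (1 : ENNReal) = ENNReal.ofReal (1 / 2) + ENNReal.ofReal (1 / 2) := by
      rw [← ENNReal.ofReal_add (by norm_num) (by norm_num)]; norm_num
    rw [h3] at h2
    exact (ENNReal.add_le_add_iff_left ENNReal.ofReal_ne_top).mp h2
  set L := √(v / D) ^ n * Real.exp (n * (δ / (4 * v) + δ / (2 * D))) with hL
  have hL0 : 0 < L := by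
    have : 0 < √(v / D) := Real.sqrt_pos.mpr (by positivity)
    positivity
  have hWQ : W G ≤ ENNReal.ofReal L * Q G := by
    rw [hWdef, hQdef, gdr_pi_gaussian c _ (by simpa using hw0),
      gdr_pi_gaussian (fun _ => m) _ (by simpa using hDv), withDensity_apply _ hmeasG,
      withDensity_apply _ hmeasG, ← lintegral_const_mul' _ _ ENNReal.ofReal_ne_top]
    refine setLIntegral_mono' hmeasG fun y hy => ?_
    rw [← ENNReal.ofReal_mul hL0.le]
    refine ENNReal.ofReal_le_ofReal ?_
    simp only [hc, hw]
    simp_rw [gdr_pdf m v D hD hDv]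
    rw [Finset.prod_mul_distrib, mul_comm]
    refine mul_le_mul_of_nonneg_right ?_
      (Finset.prod_nonneg fun i _ => gaussianPDFReal_nonneg _ _ _)
    rw [Finset.prod_mul_distrib, ← Real.exp_sum, hL]
    simp only [Finset.prod_const, Finset.card_univ, Fintype.card_fin]
    refine mul_le_mul_of_nonneg_left (Real.exp_le_exp.mpr ?_) (by positivity)
    rw [Finset.sum_sub_distrib, ← Finset.sum_div, ← Finset.sum_div, ← hS]
    have k1 : S / (2 * v) ≤ n * (v + δ / 2) / (2 * v) := by
      gcongr; linarith [hx.2]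
    have k2 : n * (D - δ) / (2 * D) ≤ (∑ i, (x i - y i) ^ 2) / (2 * D) := by
      gcongr; exact hy.1
    have k3 : n * (v + δ / 2) / (2 * v) - n * (D - δ) / (2 * D)
      = n * (δ / (4 * v) + δ / (2 * D)) := by field_simp; ring
    linarith
  have hfin : ENNReal.ofReal (1 / 2) ≤ ENNReal.ofReal L * Q G := hWG.trans hWQ
  have hsub : Q G ≤ Q {y | ∑ i, (x i - y i) ^ 2 ≤ n * (D + δ)} := measure_mono fun y hy => hy.2
  refine le_trans ?_ hsub
  rw [ENNReal.ofReal_mul (by norm_num), ENNReal.ofReal_inv_of_pos hL0, ← div_eq_mul_inv]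
  exact ENNReal.div_le_of_le_mul' hfin

lemma gdr_code (m v D : ℝ) (hD : 0 < D) (hDv : D < v) (δ : ℝ) (hδ : 0 < δ) :
    ∃ (K : ℝ) (N : ℕ), ∀ n : ℕ, N ≤ n → 1 ≤ n → ∀ (q : ℝ), 0 ≤ q → q ≤ 1 →
      q ≤ (1 / 2) * (√(v / D) ^ n * Real.exp (n * (δ / (4 * v) + δ / (2 * D))))⁻¹ →
      ∀ M : ℕ, ∃ (f : (Fin n → ℝ) → Fin (M + 1)) (g : Fin (M + 1) → (Fin n → ℝ)),
        Measurable f ∧ expectedDistortion n (M + 1) (gaussianReal m v.toNNReal) f g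
          ≤ D + 2 * δ + v * (K * (4 / δ ^ 2) / n + (1 - q) ^ M) + K / δ / n := by
  have hv : 0 < v := hD.trans hDv
  obtain ⟨N, hN⟩ := gdr_qbound m v D hD hDv δ hδ
  refine ⟨2 * ∫ y, y ^ 4 ∂(gaussianReal 0 v.toNNReal), N, fun n hn hn1 q hq0 hq1 hq M => ?_⟩
  set K := 2 * ∫ y, y ^ 4 ∂(gaussianReal 0 v.toNNReal) with hK
  have hn0 : (0 : ℝ) < n := by exact_mod_cast hn1
  set P := Measure.pi fun _ : Fin n => gaussianReal m v.toNNReal with hP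
  set Q := Measure.pi fun _ : Fin n => gaussianReal m (v - D).toNNReal with hQ
  set S : (Fin n → ℝ) → ℝ := fun x => ∑ i, (m - x i) ^ 2 with hS
  have hSm : Measurable S := by fun_prop
  have hSmem : MemLp S 2 P := gdr_sum_memLp (fun _ => m) v.toNNReal (fun _ => m)
  have hSmean : ∫ x, S x ∂P = n * v := by
    have := gdr_sum_mean (fun _ : Fin n => m) v hv (fun _ => m)
    simpa using this
  have hSvar : Var[S; P] ≤ n * K := by
    have := gdr_sum_variance (fun _ : Fin n => m) v hv (fun _ => m)
    simpa using this
  set T : Set (Fin n → ℝ) := {x | |S x - n * v| ≤ n * (δ / 2)} with hT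
  have hTm : MeasurableSet T := measurableSet_le (by fun_prop) measurable_const
  set G : Set ((Fin n → ℝ) × (Fin n → ℝ)) :=
    {p | ∑ i, (p.1 i - p.2 i) ^ 2 ≤ n * (D + δ)} with hG
  have hGm : MeasurableSet G := measurableSet_le (by fun_prop) measurable_const
  obtain ⟨f, g, U, hf, hUm, -, hg0, hPU, h1, h2⟩ :=
    gdr_cover P Q G hGm T hTm q hq0 hq1 (by
      intro x hx
      refine (ENNReal.ofReal_le_ofReal hq).trans (hN n hn x ?_)
      have : ∑ i, (x i - m) ^ 2 = S x := Finset.sum_congr rfl fun i _ => sub_sq_comm _ _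
      rw [this]; exact hx) (fun _ => m) M
  refine ⟨f, g, hf, ?_⟩
  set A := Tᶜ ∪ U with hA
  have hAm : MeasurableSet A := hTm.compl.union hUm
  have hPT : P Tᶜ ≤ ENNReal.ofReal (K * (4 / δ ^ 2) / n) := by
    have hcheb := meas_ge_le_variance_div_sq hSmem (c := n * (δ / 2)) (by positivity)
    refine (measure_mono ?_).trans (hcheb.trans (ENNReal.ofReal_le_ofReal ?_))
    · intro x hx
      simp only [hT, Set.mem_compl_iff, Set.mem_ofPred_eq, not_le] at hx ⊢
      rw [hSmean]; exact hx.le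
    · rw [div_le_iff₀ (by positivity)]
      refine hSvar.trans (le_of_eq ?_)
      field_simp
      try ring
  have hK0 : 0 ≤ K := by
    rw [hK]
    have : 0 ≤ ∫ y, y ^ 4 ∂(gaussianReal 0 v.toNNReal) :=
      integral_nonneg fun y => by positivity
    positivity
  have hPA : P.real A ≤ K * (4 / δ ^ 2) / n + (1 - q) ^ M := by
    have h0 : 0 ≤ (1 - q) ^ M := pow_nonneg (by linarith) _
    refine ENNReal.toReal_le_of_le_ofReal (by positivity) ?_
    rw [ENNReal.ofReal_add (by positivity) h0]
    exact (measure_union_le _ _).trans (add_le_add hPT hPU)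
  have hi1 : Integrable (fun _ : Fin n → ℝ => D + 2 * δ) P := integrable_const _
  have hi2 : Integrable (A.indicator fun _ : Fin n → ℝ => v) P :=
    (integrable_const v).indicator hAm
  have hi3 : Integrable (fun x => (1 / (δ * n ^ 2)) * (S x - n * v) ^ 2) P :=
    ((hSmem.sub (memLp_const (n * v))).integrable_sq).const_mul _
  have hi12 : Integrable (fun x => D + 2 * δ + A.indicator (fun _ : Fin n → ℝ => v) x) P :=
    hi1.add hi2
  have hvarint : ∫ x, (S x - n * v) ^ 2 ∂P = Var[S; P] := by
    rw [variance_eq_integral hSm.aemeasurable, hSmean]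
  have hmono : expectedDistortion n (M + 1) (gaussianReal m v.toNNReal) f g ≤
      ∫ x, (D + 2 * δ + A.indicator (fun _ : Fin n → ℝ => v) x)
        + (1 / (δ * n ^ 2)) * (S x - n * v) ^ 2 ∂P := by
    unfold expectedDistortion
    refine integral_mono_of_nonneg (Filter.Eventually.of_forall fun x => ?_) (hi12.add hi3)
      (Filter.Eventually.of_forall fun x => ?_)
    · have : 0 ≤ ∑ i, (x i - g (f x) i) ^ 2 := Finset.sum_nonneg fun i _ => sq_nonneg _
      simp only [Pi.zero_apply]
      positivity
    · simp only
      have hsq : 0 ≤ (1 / (δ * n ^ 2)) * (S x - n * v) ^ 2 := by positivity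
      have hind : 0 ≤ A.indicator (fun _ : Fin n → ℝ => v) x :=
        Set.indicator_nonneg (fun _ _ => hv.le) x
      have good : (x, g (f x)) ∈ G → 1 / (n : ℝ) * ∑ i, (x i - g (f x) i) ^ 2 ≤ D + δ := by
        intro h
        have h' : ∑ i, (x i - g (f x) i) ^ 2 ≤ n * (D + δ) := h
        rw [one_div, ← div_eq_inv_mul, div_le_iff₀ hn0]
        linarith
      by_cases hx : x ∈ A
      · rcases h2 x with h | h
        · linarith [good h]
        · rw [Set.indicator_of_mem hx, h, hg0]
          have : ∑ i, (x i - m) ^ 2 = S x := Finset.sum_congr rfl fun i _ => sub_sq_comm _ _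
          rw [this]
          set t := S x / n - v with ht
          have e1 : 1 / (n : ℝ) * S x = v + t := by rw [ht]; ring
          have e2 : (1 / (δ * n ^ 2)) * (S x - n * v) ^ 2 = t ^ 2 / δ := by
            rw [ht]; field_simp
          have e3 : t ≤ δ + t ^ 2 / δ := by
            have : δ + t ^ 2 / δ = (δ ^ 2 + t ^ 2) / δ := by field_simp
            rw [this, le_div_iff₀ hδ]
            nlinarith [sq_nonneg (t - δ), sq_nonneg (t + δ)]
          rw [e1, e2]
          linarith
      · have hxT : x ∈ T := by
          by_contra hc; exact hx (Or.inl hc)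
        have hxU : x ∉ U := fun hc => hx (Or.inr hc)
        linarith [good (h1 x hxT hxU)]
  refine hmono.trans ?_
  rw [integral_add hi12 hi3, integral_add hi1 hi2, integral_const_mul, hvarint,
    integral_indicator_const _ hAm]
  simp only [integral_const, smul_eq_mul, probReal_univ, one_mul]
  have k1 : P.real A * v ≤ v * (K * (4 / δ ^ 2) / n + (1 - q) ^ M) := by
    rw [mul_comm]; exact mul_le_mul_of_nonneg_left hPA hv.le
  have k2 : 1 / (δ * n ^ 2) * Var[S; P] ≤ K / δ / n := by
    have := mul_le_mul_of_nonneg_left hSvar (by positivity : 0 ≤ 1 / (δ * (n : ℝ) ^ 2))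
    refine this.trans (le_of_eq ?_)
    field_simp
  linarith

lemma gdr_achievable (m v R : ℝ) (hv : 0 < v) (hR : 0 < R) :
    IsAchievable (gaussianReal m v.toNNReal) R (v * 2 ^ (-(2 * R))) := by
  intro ε hε
  set D := v * (2 : ℝ) ^ (-(2 * R)) with hDdef
  have hD : 0 < D := by positivity
  have hDv : D < v := by
    have : (2 : ℝ) ^ (-(2 * R)) < 1 :=
      Real.rpow_lt_one_of_one_lt_of_neg (by norm_num) (by linarith)
    rw [hDdef]; nlinarith
  have hsqrt : √(v / D) = (2 : ℝ) ^ R := by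
    rw [Real.sqrt_eq_iff_mul_self_eq (by positivity) (by positivity), ← Real.rpow_add (by norm_num),
      div_eq_iff hD.ne', hDdef, mul_left_comm, ← Real.rpow_add (by norm_num)]
    ring_nf
    simp
  have hlog : 0 < Real.log 2 := Real.log_pos (by norm_num)
  set k := 1 / (4 * v) + 1 / (2 * D) with hk
  have hk0 : 0 < k := by positivity
  set δ := min (ε / 4) (ε / 2 * Real.log 2 / k) with hδdef
  have hδ : 0 < δ := lt_min (by positivity) (by positivity)
  have hδ1 : δ ≤ ε / 4 := min_le_left _ _
  have hδ2 : δ / (4 * v) + δ / (2 * D) ≤ ε / 2 * Real.log 2 := by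
    have h : δ ≤ ε / 2 * Real.log 2 / k := min_le_right _ _
    rw [le_div_iff₀ hk0] at h
    have : δ / (4 * v) + δ / (2 * D) = δ * k := by rw [hk]; ring
    linarith
  obtain ⟨K, N, hN⟩ := gdr_code m v D hD hDv δ hδ
  have hpow : Filter.Tendsto (fun n : ℕ => (2 : ℝ) ^ ((n : ℝ) * (ε / 2))) Filter.atTop
      Filter.atTop := by
    have h1 : Filter.Tendsto (fun n : ℕ => (n : ℝ) * (ε / 2)) Filter.atTop Filter.atTop :=
      tendsto_natCast_atTop_atTop.atTop_mul_const (by positivity)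
    exact (tendsto_rpow_atTop_of_base_gt_one 2 (by norm_num)).comp h1
  have hexp : Filter.Tendsto (fun n : ℕ => Real.exp (1 - (1 / 2) * (2 : ℝ) ^ ((n : ℝ) * (ε / 2))))
      Filter.atTop (nhds 0) := by
    refine Real.tendsto_exp_atBot.comp ?_
    have := (hpow.const_mul_atTop (by norm_num : (0 : ℝ) < 1 / 2))
    have h2 := Filter.tendsto_atBot_add_const_left Filter.atTop (1 : ℝ)
      (Filter.tendsto_neg_atTop_atBot.comp this)
    refine h2.congr fun n => ?_
    simp [sub_eq_add_neg]
  have hlim : Filter.Tendsto (fun n : ℕ => v * (K * (4 / δ ^ 2) / n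
      + Real.exp (1 - (1 / 2) * (2 : ℝ) ^ ((n : ℝ) * (ε / 2)))) + K / δ / n)
      Filter.atTop (nhds 0) := by
    have := (((tendsto_const_div_atTop_nhds_zero_nat (K * (4 / δ ^ 2))).add hexp).const_mul v).add
      (tendsto_const_div_atTop_nhds_zero_nat (K / δ))
    simpa using this
  obtain ⟨n, ⟨hn1, hnN⟩, hn2⟩ := (((Filter.eventually_ge_atTop 1).and
    (Filter.eventually_ge_atTop N)).and
    (hlim.eventually (gt_mem_nhds (by positivity : (0 : ℝ) < ε / 2)))).exists
  have hn0 : (0 : ℝ) < n := by exact_mod_cast hn1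
  set B := (2 : ℝ) ^ ((n : ℝ) * (R + ε)) with hB
  set b := (2 : ℝ) ^ ((n : ℝ) * (R + ε / 2)) with hb
  set c := (2 : ℝ) ^ ((n : ℝ) * (ε / 2)) with hc
  have hBbc : B = b * c := by
    rw [hB, hb, hc, ← Real.rpow_add (by norm_num)]; ring_nf
  have hb1 : 1 ≤ b := Real.one_le_rpow (by norm_num) (by positivity)
  have hc1 : 1 ≤ c := Real.one_le_rpow (by norm_num) (by positivity)
  have hB1 : 1 ≤ B := by rw [hBbc]; nlinarith
  have hfl : 1 ≤ ⌊B⌋₊ := Nat.one_le_floor_iff _ |>.mpr hB1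
  obtain ⟨M, hM⟩ : ∃ M, ⌊B⌋₊ = M + 1 := ⟨⌊B⌋₊ - 1, by omega⟩
  have hMB : ((M + 1 : ℕ) : ℝ) ≤ B := by rw [← hM]; exact Nat.floor_le (by linarith)
  have hMB' : B < ((M + 1 : ℕ) : ℝ) + 1 := by rw [← hM]; exact Nat.lt_floor_add_one B
  have hLb : √(v / D) ^ n * Real.exp (n * (δ / (4 * v) + δ / (2 * D))) ≤ b := by
    have e1 : b = √(v / D) ^ n * Real.exp (n * (ε / 2 * Real.log 2)) := by
      rw [hsqrt, ← Real.rpow_mul_natCast (by norm_num), hb, mul_add, Real.rpow_add (by norm_num),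
        mul_comm R]
      congr 1
      rw [Real.rpow_def_of_pos (by norm_num)]
      congr 1; ring
    rw [e1]
    gcongr
  have hL0 : 0 < √(v / D) ^ n * Real.exp (n * (δ / (4 * v) + δ / (2 * D))) := by
    rw [hsqrt]; positivity
  have hq1 : 1 / 2 * b⁻¹ ≤ 1 := by
    have : b⁻¹ ≤ 1 := inv_le_one_of_one_le₀ hb1
    linarith
  obtain ⟨f, g, hf, hfg⟩ := hN n hnN hn1 (1 / 2 * b⁻¹) (by positivity) hq1
    (by gcongr) M
  refine ⟨n, M + 1, f, g, hn1, hf, hMB, hfg.trans ?_⟩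
  have hqM : (1 - 1 / 2 * b⁻¹) ^ M ≤ Real.exp (1 - (1 / 2) * c) := by
    have h1 : 1 - 1 / 2 * b⁻¹ ≤ Real.exp (-(1 / 2 * b⁻¹)) := by
      have := Real.add_one_le_exp (-(1 / 2 * b⁻¹)); linarith
    calc (1 - 1 / 2 * b⁻¹) ^ M ≤ Real.exp (-(1 / 2 * b⁻¹)) ^ M :=
          pow_le_pow_left₀ (by linarith) h1 M
      _ = Real.exp (M * (-(1 / 2 * b⁻¹))) := (Real.exp_nat_mul _ _).symm
      _ ≤ _ := by
        refine Real.exp_le_exp.mpr ?_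
        have hM2 : b * c - 2 ≤ M := by
          push_cast at hMB'; rw [hBbc] at hMB'; linarith
        have h3 : (b * c - 2) * (1 / 2 * b⁻¹) ≤ M * (1 / 2 * b⁻¹) :=
          mul_le_mul_of_nonneg_right hM2 (by positivity)
        have h4 : (b * c - 2) * (1 / 2 * b⁻¹) = 1 / 2 * c - b⁻¹ := by field_simp
        have : b⁻¹ ≤ 1 := inv_le_one_of_one_le₀ hb1
        linarith
  have : v * (K * (4 / δ ^ 2) / n + (1 - 1 / 2 * b⁻¹) ^ M) ≤
      v * (K * (4 / δ ^ 2) / n + Real.exp (1 - (1 / 2) * c)) := by gcongr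
  linarith

lemma gdr_achievable_zero (m v : ℝ) (hv : 0 < v) :
    IsAchievable (gaussianReal m v.toNNReal) 0 v := by
  intro ε hε
  refine ⟨1, 1, fun _ => 0, fun _ _ => m, le_rfl, measurable_const, ?_, ?_⟩
  · simpa using Real.one_le_rpow (x := 2) (by norm_num) hε.le
  · unfold expectedDistortion
    have h := integral_comp_eval (μ := fun _ : Fin 1 => gaussianReal m v.toNNReal) (i := 0)
      (f := fun y => (y - m) ^ 2) (gdr_sq_integrable m _ m).aestronglyMeasurable
    rw [gdr_var m v hv] at h
    simp only [Nat.cast_one, div_one, one_mul, Finset.univ_unique, Finset.sum_singleton,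
      Fin.default_eq_zero]
    rw [h]; linarith

/-- Theorem 1 of the paper (distortion-rate form): for a Gaussian memoryless scalar
source of variance `σ²`, the distortion-rate function equals `σ² * 2 ^ (-2R)`. -/
theorem gaussian_distortion_rate_function
    (m σ : ℝ) (hσ : 0 < σ)
    (μ : Measure ℝ) (hμ : μ = gaussianReal m (Real.toNNReal (σ ^ 2)))
    (R : ℝ) (hR : 0 ≤ R) :
    sInf {D : ℝ | 0 ≤ D ∧ IsAchievable μ R D} = σ ^ 2 * 2 ^ (-(2 * R)) := by
  have hv : 0 < σ ^ 2 := by positivity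
  subst hμ
  refine IsLeast.csInf_eq ⟨⟨by positivity, ?_⟩, ?_⟩
  · rcases hR.eq_or_lt with h | h
    · subst h
      simpa using gdr_achievable_zero m (σ ^ 2) hv
    · exact gdr_achievable m (σ ^ 2) R hv h
  · rintro D ⟨-, hD⟩
    have key : ∀ ε > 0, σ ^ 2 * (2 : ℝ) ^ (-(2 * (R + ε))) ≤ D + ε := by
      intro ε hε
      obtain ⟨n, M, f, g, hn, hf, hM, hd⟩ := hD ε hε
      refine le_trans ?_ hd
      refine gdr_converse m (σ ^ 2) _ hv (by positivity) n M hn f hf g ?_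
      rw [mul_div_cancel_left₀ _ hv.ne']
      have : √((2 : ℝ) ^ (-(2 * (R + ε)))) = 2 ^ (-(R + ε)) := by
        rw [Real.sqrt_eq_iff_mul_self_eq (by positivity) (by positivity),
          ← Real.rpow_add (by norm_num)]
        ring_nf
      rw [this, ← Real.rpow_mul_natCast (by norm_num)]
      calc (M : ℝ) * 2 ^ (-(R + ε) * n) ≤ 2 ^ ((n : ℝ) * (R + ε)) * 2 ^ (-(R + ε) * n) := by
            gcongr
        _ = 1 := by
            rw [← Real.rpow_add (by norm_num)]
            ring_nf
            simp
    have l1 : Filter.Tendsto (fun ε : ℝ => σ ^ 2 * (2 : ℝ) ^ (-(2 * (R + ε))))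
        (nhdsWithin 0 (Set.Ioi 0)) (nhds (σ ^ 2 * (2 : ℝ) ^ (-(2 * R)))) := by
      have : Continuous (fun ε : ℝ => σ ^ 2 * (2 : ℝ) ^ (-(2 * (R + ε)))) :=
        continuous_const.mul (Continuous.rpow continuous_const (by fun_prop)
          (fun x => Or.inl (by norm_num)))
      have h := this.tendsto 0
      simp only [add_zero] at h
      exact h.mono_left nhdsWithin_le_nhds
    have l2 : Filter.Tendsto (fun ε : ℝ => D + ε) (nhdsWithin 0 (Set.Ioi 0)) (nhds D) := by
      have : Continuous (fun ε : ℝ => D + ε) := by fun_prop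
      have h := this.tendsto 0
      simp only [add_zero] at h
      exact h.mono_left nhdsWithin_le_nhds
    exact le_of_tendsto_of_tendsto l1 l2
      (Filter.eventually_of_mem self_mem_nhdsWithin fun ε hε => key ε hε)
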